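/- arXiv:1608.03878 — 4 statements merged into one kernel-verified Lean document; each statement's English description precedes it below -/
import Mathlib

section
/- Let (εₙ) be positive reals with εₙ → 0 and for each n let vₙ : ℝ → ℝ be continuous on I = (−1,1) and locally absolutely continuous on I with a.e. derivative hₙ, with 0 ≤ vₙ(x) ≤ 1 for x ∈ I, vₙ → 1 in L¹(I) and vₙ(x) → 1 for a.e. x ∈ I, and suppose that limsup_{n→∞} ∫_I [ (εₙ/2) hₙ(x)² + (1/(2εₙ)) (vₙ(x) − 1)² ] dx < ∞. Then for every η ∈ (0,1) there exist a strictly increasing map φ : ℕ → ℕ and an open set H_η ⊆ I such that I ∖ H_η is a finite set, and for every compact set K ⊆ H_η there is n₀ ∈ ℕ with K ⊆ { x ∈ I : v_{φ(n)}(x)² ≥ η } for all n ≥ n₀. -/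
open MeasureTheory Filter Set
open scoped ENNReal

/-- `f` is absolutely continuous on `[a, b]` with a.e. derivative `f'`, encoded via the
fundamental theorem of calculus for the Lebesgue integral. -/
def ACderivOn (f f' : ℝ → ℝ) (a b : ℝ) : Prop :=
  IntervalIntegrable f' volume a b ∧
    ∀ x ∈ Set.Icc a b, f x = f a + ∫ t in a..x, f' t

/-- `f` is locally absolutely continuous on the open set `U` with a.e. derivative `f'`:
it is absolutely continuous with derivative `f'` on every compact subinterval of `U`. -/
def LocACOn (f f' : ℝ → ℝ) (U : Set ℝ) : Prop :=
  ∀ a b : ℝ, a ≤ b → Set.Icc a b ⊆ U → ACderivOn f f' a b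

/-- If no subsequence of a sequence of sets can accumulate at more than `N` points of `I`, then along
some subsequence the set of points of `I` where the sets accumulate is finite. -/
theorem exists_subseq_finite_accumulation {X : Type*} [PseudoMetricSpace X] (B : ℕ → Set X)
    (I : Set X) (N : ℕ)
    (hN : ∀ φ : ℕ → ℕ, StrictMono φ → ∀ F : Finset X, (F : Set X) ⊆ I →
      (∀ x ∈ F, ∀ δ > 0, ∀ᶠ n in atTop, (B (φ n) ∩ Metric.ball x δ).Nonempty) → F.card ≤ N) :
    ∃ φ : ℕ → ℕ, StrictMono φ ∧
      {x ∈ I | ∀ δ > 0, ∃ᶠ n in atTop, (B (φ n) ∩ Metric.ball x δ).Nonempty}.Finite := by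
  by_contra! hinf
  have key : ∀ k : ℕ, ∃ φ : ℕ → ℕ, StrictMono φ ∧ ∃ F : Finset X, (F : Set X) ⊆ I ∧
      (∀ x ∈ F, ∀ δ > 0, ∀ᶠ n in atTop, (B (φ n) ∩ Metric.ball x δ).Nonempty) ∧ F.card = k := by
    intro k
    induction k with
    | zero => exact ⟨id, strictMono_id, ∅, by simp⟩
    | succ k ih =>
      obtain ⟨φ, hφ, F, hFI, hF, hcard⟩ := ih
      obtain ⟨x, ⟨hxI, hx⟩, hxF⟩ := Set.Infinite.exists_notMem_finset (hinf φ hφ) F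
      obtain ⟨ψ, hψ, hψx⟩ := extraction_forall_of_frequently
        (fun k : ℕ => hx (1 / ((k : ℝ) + 1)) Nat.one_div_pos_of_nat)
      refine ⟨φ ∘ ψ, hφ.comp hψ, F.cons x hxF, ?_, ?_, by simp [hcard]⟩
      · simpa [Set.insert_subset_iff] using ⟨hxI, hFI⟩
      · intro z hz δ hδ
        rcases Finset.mem_cons.1 hz with rfl | hz
        · filter_upwards [tendsto_one_div_add_atTop_nhds_zero_nat.eventually_lt_const hδ] with n hn
          exact (hψx n).mono (inter_subset_inter_right _ (Metric.ball_subset_ball hn.le))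
        · exact hψ.tendsto_atTop.eventually (hF z hz δ hδ)
  obtain ⟨φ, hφ, F, hFI, hF, hcard⟩ := key (N + 1)
  have := hN φ hφ F hFI hF
  omega

/-- The Ambrosio–Tortorelli energy cost of a transition from a value at most `s` to a value at
least `t`, where `t < 1`. -/
theorem transition_energy_lower_bound_s4 {v h : ℝ → ℝ} {U : Set ℝ} {ε s t x y : ℝ} (hε : 0 < ε)
    (ht : t < 1) (hxy : x ≤ y) (hU : Set.Icc x y ⊆ U) (hvc : ContinuousOn v U)
    (hv : LocACOn v h U) (hx : v x ≤ s) (hy : t ≤ v y) :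
    ENNReal.ofReal ((1 - t) * (t - s)) ≤ ∫⁻ z in Set.Ioo x y,
      ENNReal.ofReal ((ε / 2) * (h z) ^ 2 + (1 / (2 * ε)) * (v z - 1) ^ 2) := by
  have hcl : IsClosed (Set.Icc x y ∩ v ⁻¹' Set.Ici t) :=
    (hvc.mono hU).preimage_isClosed_of_isClosed isClosed_Icc isClosed_Ici
  obtain ⟨b, ⟨hb, hbt⟩, hleast⟩ := (isCompact_Icc.of_isClosed_subset hcl
    inter_subset_left).exists_isLeast ⟨y, right_mem_Icc.2 hxy, hy⟩
  have hbelow : ∀ z ∈ Set.Ioo x b, v z < t := by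
    intro z hz
    by_contra! hzt
    exact hz.2.not_ge (hleast ⟨⟨hz.1.le, hz.2.le.trans hb.2⟩, hzt⟩)
  have hint := (hv x b hb.1 ((Set.Icc_subset_Icc_right hb.2).trans hU)).2 b (right_mem_Icc.2 hb.1)
  rw [intervalIntegral.integral_of_le hb.1, integral_Ioc_eq_integral_Ioo] at hint
  have hbt' : t ≤ v b := hbt
  calc ENNReal.ofReal ((1 - t) * (t - s))
      = ENNReal.ofReal (1 - t) * ENNReal.ofReal (t - s) := ENNReal.ofReal_mul (by linarith)
    _ ≤ ENNReal.ofReal (1 - t) * ∫⁻ z in Set.Ioo x b, ‖h z‖ₑ := by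
        gcongr
        refine le_trans ?_ (enorm_integral_le_lintegral_enorm _)
        rw [Real.enorm_eq_ofReal_abs]
        exact ENNReal.ofReal_le_ofReal (le_trans (by linarith) (le_abs_self _))
    _ = ∫⁻ z in Set.Ioo x b, ENNReal.ofReal (1 - t) * ‖h z‖ₑ :=
        (lintegral_const_mul' _ _ ENNReal.ofReal_ne_top).symm
    _ ≤ ∫⁻ z in Set.Ioo x b,
          ENNReal.ofReal ((ε / 2) * (h z) ^ 2 + (1 / (2 * ε)) * (v z - 1) ^ 2) := by
        refine setLIntegral_mono' measurableSet_Ioo fun z hz => ?_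
        rw [Real.enorm_eq_ofReal_abs, ← ENNReal.ofReal_mul (by linarith)]
        refine ENNReal.ofReal_le_ofReal ?_
        have hyoung : (ε / 2) * (h z) ^ 2 + (1 / (2 * ε)) * (v z - 1) ^ 2
            = (1 - v z) * |h z| + (ε * |h z| - (1 - v z)) ^ 2 / (2 * ε) := by
          rw [← sq_abs (h z)]
          field_simp
          ring
        rw [hyoung]
        have hle : (1 - t) * |h z| ≤ (1 - v z) * |h z| :=
          mul_le_mul_of_nonneg_right (by linarith [hbelow z hz]) (abs_nonneg _)
        have : 0 ≤ (ε * |h z| - (1 - v z)) ^ 2 / (2 * ε) := by positivity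
        linarith
    _ ≤ _ := lintegral_mono_set (Set.Ioo_subset_Ioo_right hb.2)

/-- If every open neighbourhood inside `I` of each point of a finite set eventually carries mass at
least `c`, then eventually the total mass in `I` is at least `c` times the number of points. -/
theorem eventually_card_mul_le_lintegral {X : Type*} [TopologicalSpace X] [T2Space X]
    [MeasurableSpace X] [OpensMeasurableSpace X] {μ : Measure X} {I : Set X} (hI : IsOpen I)
    {g : ℕ → X → ℝ≥0∞} {c : ℝ≥0∞} {F : Finset X} (hFI : (F : Set X) ⊆ I)
    (hF : ∀ x ∈ F, ∀ V ⊆ I, IsOpen V → x ∈ V → ∀ᶠ n in atTop, c ≤ ∫⁻ z in V, g n z ∂μ) :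
    ∀ᶠ n in atTop, F.card * c ≤ ∫⁻ z in I, g n z ∂μ := by
  obtain ⟨U, hU, hdisj⟩ := F.finite_toSet.t2_separation
  have hev : ∀ᶠ n in atTop, ∀ x ∈ F, c ≤ ∫⁻ z in U x ∩ I, g n z ∂μ :=
    (Filter.eventually_all_finset F).2 fun x hx =>
      hF x hx _ inter_subset_right ((hU x).2.inter hI) ⟨(hU x).1, hFI hx⟩
  filter_upwards [hev] with n hn
  calc F.card * c = ∑ _x ∈ F, c := by simp
    _ ≤ ∑ x ∈ F, ∫⁻ z in U x ∩ I, g n z ∂μ := Finset.sum_le_sum hn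
    _ = ∫⁻ z in ⋃ x ∈ F, U x ∩ I, g n z ∂μ :=
        (lintegral_biUnion_finset (hdisj.mono fun _ => inter_subset_left)
          (fun x _ => ((hU x).2.inter hI).measurableSet) _).symm
    _ ≤ _ := lintegral_mono_set (Set.iUnion₂_subset fun _ _ => inter_subset_right)

/-- A sequence of phase fields with bounded Ambrosio–Tortorelli transition energy stays,
along a subsequence, uniformly close to `1` on compact subsets of the complement of
finitely many points of `I = (-1, 1)`. -/
theorem phase_field_compactness_1d
    (ε : ℕ → ℝ) (hεpos : ∀ n, 0 < ε n) (hε0 : Tendsto ε atTop (nhds 0))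
    (vn hn : ℕ → ℝ → ℝ)
    (hvc : ∀ n, ContinuousOn (vn n) (Set.Ioo (-1 : ℝ) 1))
    (hvAC : ∀ n, LocACOn (vn n) (hn n) (Set.Ioo (-1 : ℝ) 1))
    (hv01 : ∀ n, ∀ x ∈ Set.Ioo (-1 : ℝ) 1, 0 ≤ vn n x ∧ vn n x ≤ 1)
    (hvL1 : Tendsto (fun n => ∫⁻ x in Set.Ioo (-1 : ℝ) 1,
      ENNReal.ofReal |vn n x - 1|) atTop (nhds 0))
    (hvae : ∀ᵐ x ∂(volume.restrict (Set.Ioo (-1 : ℝ) 1)),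
      Tendsto (fun n => vn n x) atTop (nhds 1))
    (hbdd : Filter.limsup (fun n => ∫⁻ x in Set.Ioo (-1 : ℝ) 1,
        ENNReal.ofReal ((ε n / 2) * (hn n x) ^ 2 +
          (1 / (2 * ε n)) * (vn n x - 1) ^ 2)) atTop < ⊤) :
    ∀ η : ℝ, η ∈ Set.Ioo (0 : ℝ) 1 →
      ∃ φ : ℕ → ℕ, StrictMono φ ∧
        ∃ Hη : Set ℝ, IsOpen Hη ∧ Hη ⊆ Set.Ioo (-1 : ℝ) 1 ∧
          (Set.Ioo (-1 : ℝ) 1 \ Hη).Finite ∧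
          ∀ K : Set ℝ, IsCompact K → K ⊆ Hη →
            ∃ n₀ : ℕ, ∀ n ≥ n₀,
              K ⊆ {x ∈ Set.Ioo (-1 : ℝ) 1 | η ≤ (vn (φ n) x) ^ 2} := by
  intro η hη
  set E : ℕ → ℝ → ℝ≥0∞ := fun n x => ENNReal.ofReal ((ε n / 2) * (hn n x) ^ 2 +
    (1 / (2 * ε n)) * (vn n x - 1) ^ 2)
  set B : ℕ → Set ℝ := fun n => {x ∈ Set.Ioo (-1 : ℝ) 1 | (vn n x) ^ 2 < η}
  obtain ⟨M, hlimM, hM⟩ := exists_between hbdd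
  have hEM := eventually_lt_of_limsup_lt hlimM
  have hs : √η < 1 := by simpa using (Real.sqrt_lt_sqrt hη.1.le hη.2)
  obtain ⟨t, hst, ht⟩ := exists_between hs
  set c := ENNReal.ofReal ((1 - t) * (t - √η))
  have hc : c ≠ 0 :=
    (ENNReal.ofReal_pos.2 (mul_pos (by linarith) (by linarith))).ne'
  have hdense := Measure.dense_of_ae ((ae_restrict_iff' measurableSet_Ioo).1 hvae)
  have hlocal : ∀ φ : ℕ → ℕ, StrictMono φ → ∀ x : ℝ,
      (∀ δ > 0, ∀ᶠ n in atTop, (B (φ n) ∩ Metric.ball x δ).Nonempty) →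
      ∀ V ⊆ Set.Ioo (-1 : ℝ) 1, IsOpen V → x ∈ V →
        ∀ᶠ n in atTop, c ≤ ∫⁻ z in V, E (φ n) z := by
    intro φ hφ x hx V hVI hV hxV
    obtain ⟨δ, hδ, hδV⟩ := Metric.isOpen_iff.1 hV x hxV
    rw [Real.ball_eq_Ioo] at hδV
    obtain ⟨y, hy, hxy, hyδ⟩ := hdense.exists_between (show x + δ / 2 < x + δ by linarith)
    have hyt := (hy (hVI (hδV ⟨by linarith, hyδ⟩))).comp hφ.tendsto_atTop
    filter_upwards [hx (δ / 2) (half_pos hδ), Tendsto.eventually_const_le ht hyt] with n hne hyn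
    obtain ⟨w, ⟨-, hwη⟩, hwx⟩ := hne
    rw [Real.ball_eq_Ioo] at hwx
    have hsub : Set.Icc w y ⊆ V := fun z hz =>
      hδV ⟨by linarith [hz.1, hwx.1], by linarith [hz.2]⟩
    exact (transition_energy_lower_bound_s4 (hεpos _) ht (by linarith [hwx.2]) (hsub.trans hVI)
      (hvc _) (hvAC _) ((le_abs_self _).trans (Real.abs_le_sqrt hwη.le)) hyn).trans
      (lintegral_mono_set (Set.Ioo_subset_Icc_self.trans hsub))
  obtain ⟨N, hNM⟩ := ENNReal.exists_nat_mul_gt hc hM.ne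
  obtain ⟨φ, hφ, hfin⟩ := exists_subseq_finite_accumulation B (Set.Ioo (-1 : ℝ) 1) N (by
    intro φ hφ F hFI hF
    obtain ⟨n, hn1, hn2⟩ := ((eventually_card_mul_le_lintegral isOpen_Ioo hFI
      fun x hx => hlocal φ hφ x (hF x hx)).and (hφ.tendsto_atTop.eventually hEM)).exists
    by_contra! hlt
    have hle : (N : ℝ≥0∞) * c ≤ F.card * c := by gcongr
    exact (hNM.trans_le (hle.trans hn1)).not_gt hn2)
  refine ⟨φ, hφ, Set.Ioo (-1 : ℝ) 1 \ _, isOpen_Ioo.sdiff hfin.isClosed, sdiff_subset,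
    hfin.subset fun x hx => by_contra fun h => hx.2 ⟨hx.1, h⟩, fun K hK hKH => ?_⟩
  have hev : ∀ᶠ n in atTop, ∀ x ∈ K, x ∉ B (φ n) := by
    refine hK.induction_on (p := fun K => ∀ᶠ n in atTop, ∀ x ∈ K, x ∉ B (φ n)) (by simp)
      (fun s t hst h => h.mono fun n hn x hx => hn x (hst hx))
      (fun s t h1 h2 => (h1.and h2).mono fun n hn x hx => hx.elim (hn.1 x) (hn.2 x)) ?_
    intro x hx
    have hx' : ∃ δ > 0, ∀ᶠ n in atTop, ¬ (B (φ n) ∩ Metric.ball x δ).Nonempty := by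
      by_contra! hcon
      exact (hKH hx).2 ⟨(hKH hx).1, fun δ hδ => by simpa using hcon δ hδ⟩
    obtain ⟨δ, hδ, hxδ⟩ := hx'
    exact ⟨Metric.ball x δ, mem_nhdsWithin_of_mem_nhds (Metric.ball_mem_nhds x hδ),
      hxδ.mono fun n hn z hz hzB => hn ⟨z, hzB, hz⟩⟩
  obtain ⟨n₀, hn₀⟩ := eventually_atTop.1 hev
  exact ⟨n₀, fun n hn x hx => ⟨(hKH hx).1, not_lt.1 fun h => hn₀ n hn x hx ⟨(hKH hx).1, h⟩⟩⟩
end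

section
/- Let ω : ℝ → ℝ and x ∈ ℝ, and suppose that ω(t) → a as t → x from the left (along the punctured left neighborhood filter). Let (Kₙ) be a sequence of nonempty compact subsets of (−∞, x) whose Hausdorff distance to the singleton {x} tends to 0. Then sup_{t ∈ Kₙ} ω(t) → a as n → ∞ (in particular the suprema are eventually well-defined real numbers). -/
open Filter Set

/-- Nonempty bounded sets converging to a singleton in Hausdorff distance eventually enter every
neighborhood of the point. -/
theorem tendsto_smallSets_nhds_of_hausdorffDist {ι X : Type*} [PseudoMetricSpace X]
    {l : Filter ι} {K : ι → Set X} {x : X} (hne : ∀ i, (K i).Nonempty)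
    (hb : ∀ i, Bornology.IsBounded (K i))
    (hd : Tendsto (fun i => Metric.hausdorffDist (K i) {x}) l (nhds 0)) :
    Tendsto K l (nhds x).smallSets := by
  refine Metric.nhds_basis_ball.smallSets.tendsto_right_iff.2 fun ε hε => ?_
  filter_upwards [hd.eventually_lt_const hε] with i hi t ht
  obtain ⟨y, rfl, hy⟩ := Metric.exists_dist_lt_of_hausdorffDist_lt ht hi
    (Metric.hausdorffEDist_ne_top_of_nonempty_of_bounded (hne i) (singleton_nonempty x) (hb i)
      Bornology.isBounded_singleton)
  exact hy

/-- If `f` tends to `a` along `l`, then so do its suprema over nonempty sets that eventually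
enter every member of `l`. -/
theorem tendsto_sSup_image_of_tendsto_smallSets {ι α : Type*} {l : Filter α} {l' : Filter ι}
    {f : α → ℝ} {a : ℝ} {K : ι → Set α} (hf : Tendsto f l (nhds a)) (hne : ∀ i, (K i).Nonempty)
    (hK : Tendsto K l' l.smallSets) :
    Tendsto (fun i => sSup (f '' K i)) l' (nhds a) := by
  refine Metric.nhds_basis_closedBall.tendsto_right_iff.2 fun ε hε => ?_
  filter_upwards [tendsto_smallSets_iff.1 hK _ (hf (Metric.closedBall_mem_nhds a hε))] with i hi
  rw [Real.closedBall_eq_Icc] at hi ⊢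
  have hsub : f '' K i ⊆ Icc (a - ε) (a + ε) := image_subset_iff.2 hi
  obtain ⟨y, hy⟩ := (hne i).image f
  exact ⟨(hsub hy).1.trans (le_csSup (bddAbove_Icc.mono hsub) hy),
    csSup_le ⟨y, hy⟩ fun z hz => (hsub hz).2⟩

/-- Part 3 of Lemma 2.4 (left side): if `ω` has one-sided limit `a` at `x` from the left,
and `Kₙ` are nonempty compact subsets of `(-∞, x)` converging to `{x}` in Hausdorff
distance, then `sup_{t ∈ Kₙ} ω(t) → a`. -/
theorem sup_tendsto_one_sided_limit_of_hausdorff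
    (ω : ℝ → ℝ) (x a : ℝ)
    (ha : Tendsto ω (nhdsWithin x (Set.Iio x)) (nhds a))
    (K : ℕ → Set ℝ)
    (hKne : ∀ n, (K n).Nonempty)
    (hKc : ∀ n, IsCompact (K n))
    (hKsub : ∀ n, K n ⊆ Set.Iio x)
    (hKd : Tendsto (fun n => Metric.hausdorffDist (K n) {x}) atTop (nhds 0)) :
    Tendsto (fun n => sSup (ω '' K n)) atTop (nhds a) := by
  refine tendsto_sSup_image_of_tendsto_smallSets ha hKne ?_
  rw [nhdsWithin, smallSets_inf, smallSets_principal]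
  exact tendsto_inf.2 ⟨tendsto_smallSets_nhds_of_hausdorffDist hKne
    (fun n => (hKc n).isBounded) hKd, tendsto_principal.2 (Eventually.of_forall hKsub)⟩
end

section
/- Let ε > 0, let a < b be real numbers, and let v : ℝ → ℝ be absolutely continuous on [a, b] with almost-everywhere derivative g. Then ∫_a^b [ (ε/2) g(t)² + (1/(2ε)) (1 − v(t))² ] dt ≥ (1/2) | (1 − v(b))² − (1 − v(a))² |, where the left-hand side is a Lebesgue integral with values in [0, ∞]. -/
open MeasureTheory Filter Set
open scoped ENNReal

/-- Fundamental theorem of calculus for `(c - f)²`, where `f` is absolutely continuous. -/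
theorem ACderivOn.integral_const_sub_mul {f f' : ℝ → ℝ} {a b : ℝ} (hab : a ≤ b)
    (hf : ACderivOn f f' a b) (c : ℝ) :
    ∫ t in a..b, (c - f t) * f' t = (1 / 2) * ((c - f a) ^ 2 - (c - f b) ^ 2) := by
  obtain ⟨hint, hval⟩ := hf
  -- `F` agrees with `f - c` on `[a, b]` and is an integral function on all of `ℝ`.
  set F : ℝ → ℝ := fun x ↦ (∫ t in a..x, f' t) - (c - f a) with hF
  have hFf : ∀ x ∈ Icc a b, F x = f x - c := fun x hx ↦ by
    rw [hF, hval x hx]; ring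
  have hac : AbsolutelyContinuousOnInterval F a b :=
    (hint.absolutelyContinuousOnInterval_intervalIntegral left_mem_uIcc).fun_sub
      (LipschitzWith.const (c - f a)).lipschitzOnWith.absolutelyContinuousOnInterval
  have hparts := hac.integral_deriv_mul_eq_sub hac
  rw [hFf a (left_mem_Icc.2 hab), hFf b (right_mem_Icc.2 hab)] at hparts
  have hcongr : ∫ t in a..b, (c - f t) * f' t =
      ∫ t in a..b, (-1 / 2) * (deriv F t * F t + F t * deriv F t) := by
    apply intervalIntegral.integral_congr_ae
    filter_upwards [hint.ae_hasDerivAt_integral] with x hx hxab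
    have hx' : x ∈ uIcc a b := uIoc_subset_uIcc hxab
    have hd : deriv F x = f' x := ((hx hx' a left_mem_uIcc).sub_const _).deriv
    rw [hd, hFf x (uIcc_of_le hab ▸ hx')]
    ring
  rw [hcongr, intervalIntegral.integral_const_mul, hparts]
  ring

/-- Young's inequality with parameter: `|x y| ≤ (ε / 2) y² + (1 / (2 ε)) x²`. -/
theorem abs_mul_le_young {ε : ℝ} (hε : 0 < ε) (x y : ℝ) :
    |x * y| ≤ (ε / 2) * y ^ 2 + (1 / (2 * ε)) * x ^ 2 := by
  have h : (ε / 2) * y ^ 2 + (1 / (2 * ε)) * x ^ 2 - |x * y| =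
      (1 / (2 * ε)) * (ε * |y| - |x|) ^ 2 := by
    rw [abs_mul, ← sq_abs x, ← sq_abs y]
    field_simp
    ring
  have : 0 ≤ (1 / (2 * ε)) * (ε * |y| - |x|) ^ 2 := by positivity
  linarith

/-- One-dimensional transition-energy lower bound: the Ambrosio–Tortorelli transition
energy of `v` on `[a, b]` dominates half the variation of `(1 - v)²` between the
endpoints. -/
theorem transition_energy_lower_bound
    (ε : ℝ) (hε : 0 < ε) (a b : ℝ) (hab : a < b)
    (v g : ℝ → ℝ) (hv : ACderivOn v g a b) :
    ENNReal.ofReal ((1 / 2) * |(1 - v b) ^ 2 - (1 - v a) ^ 2|) ≤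
      ∫⁻ t in Set.Icc a b,
        ENNReal.ofReal ((ε / 2) * (g t) ^ 2 + (1 / (2 * ε)) * (1 - v t) ^ 2) := by
  calc ENNReal.ofReal ((1 / 2) * |(1 - v b) ^ 2 - (1 - v a) ^ 2|)
      = ‖∫ t in a..b, (1 - v t) * g t‖ₑ := by
        rw [hv.integral_const_sub_mul hab.le, Real.enorm_eq_ofReal_abs, abs_mul,
          abs_of_pos (by norm_num : (0 : ℝ) < 1 / 2), abs_sub_comm]
    _ = ‖∫ t in Icc a b, (1 - v t) * g t‖ₑ := by
        rw [intervalIntegral.integral_of_le hab.le, integral_Icc_eq_integral_Ioc]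
    _ ≤ ∫⁻ t in Icc a b, ‖(1 - v t) * g t‖ₑ := enorm_integral_le_lintegral_enorm _
    _ ≤ _ := lintegral_mono fun t ↦ by
        rw [Real.enorm_eq_ofReal_abs]
        exact ENNReal.ofReal_le_ofReal (abs_mul_le_young hε _ _)
end

section
/- Let C > 0 and let c : ℝ → ℝ be continuous on [−1, 1] and absolutely continuous on [−1, 1] with almost-everywhere derivative g satisfying ∫_{−1}^{1} |g(x)| dx ≤ C. Then for all real numbers 0 < σ < δ there exists t ∈ (σ, δ) such that the level set { x ∈ (−1, 1) : c(x) = t } is finite and has at most C / (δ − σ) elements. -/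
open MeasureTheory Filter Set
open scoped ENNReal

/-- The `i`-th point of the uniform partition of `[a, b]` into `n` pieces. -/
noncomputable def partitionPoint (a b : ℝ) (n i : ℕ) : ℝ := a + (b - a) * (i / n)

lemma partitionPoint_zero (a b : ℝ) (n : ℕ) : partitionPoint a b n 0 = a := by
  simp [partitionPoint]

lemma partitionPoint_self (a b : ℝ) {n : ℕ} (hn : 0 < n) : partitionPoint a b n n = b := by
  have : (n : ℝ) ≠ 0 := by positivity
  simp [partitionPoint, this]

lemma partitionPoint_mono {a b : ℝ} (hab : a ≤ b) (n : ℕ) : Monotone (partitionPoint a b n) := by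
  intro i j hij
  have : 0 ≤ b - a := sub_nonneg.2 hab
  unfold partitionPoint
  gcongr

lemma partitionPoint_mem_Icc {a b : ℝ} (hab : a ≤ b) {n i : ℕ} (hn : 0 < n) (hi : i ≤ n) :
    partitionPoint a b n i ∈ Icc a b :=
  ⟨(partitionPoint_zero a b n).symm.le.trans (partitionPoint_mono hab n (Nat.zero_le i)),
    (partitionPoint_mono hab n hi).trans (partitionPoint_self a b hn).le⟩

/-- The image of a subinterval under an absolutely continuous function has measure at most
the integral of the absolute value of the derivative. -/
lemma ACderivOn.volume_image_Icc_le {f f' : ℝ → ℝ} {a b u v : ℝ} (h : ACderivOn f f' a b)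
    (hau : a ≤ u) (huv : u ≤ v) (hvb : v ≤ b) :
    volume (f '' Icc u v) ≤ ENNReal.ofReal (∫ x in u..v, |f' x|) := by
  obtain ⟨hint, hf⟩ := h
  have hsub : ∀ {x y : ℝ}, x ∈ Icc a b → y ∈ Icc a b → IntervalIntegrable f' volume x y := by
    intro x y hx hy
    refine hint.mono_set ?_
    rw [uIcc_of_le (hau.trans (huv.trans hvb))]
    exact uIcc_subset_Icc hx hy
  have ha : a ∈ Icc a b := ⟨le_rfl, hau.trans (huv.trans hvb)⟩
  have hmem : ∀ {x : ℝ}, x ∈ Icc u v → x ∈ Icc a b := fun hx =>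
    ⟨hau.trans hx.1, hx.2.trans hvb⟩
  refine (Real.volume_le_diam _).trans (Metric.ediam_le ?_)
  rintro _ ⟨x, hx, rfl⟩ _ ⟨y, hy, rfl⟩
  rw [edist_dist, Real.dist_eq]
  refine ENNReal.ofReal_le_ofReal ?_
  have hxy : f x - f y = ∫ t in y..x, f' t := by
    rw [hf x (hmem hx), hf y (hmem hy), add_sub_add_left_eq_sub,
      intervalIntegral.integral_interval_sub_left (hsub ha (hmem hx)) (hsub ha (hmem hy))]
  rw [hxy]
  refine (intervalIntegral.norm_integral_le_integral_norm_uIoc (f := f')).trans ?_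
  rw [intervalIntegral.integral_of_le huv]
  refine setIntegral_mono_set ?_ (ae_of_all _ fun _ => abs_nonneg _) ?_
  · exact (hsub (hmem ⟨le_rfl, huv⟩) (hmem ⟨huv, le_rfl⟩)).abs.1
  · refine LE.le.eventuallyLE fun z hz => ?_
    exact ⟨(le_min hy.1 hx.1).trans_lt hz.1, hz.2.trans (max_le hy.2 hx.2)⟩

/-- The images of the cells of a uniform partition have total measure at most the total
variation. -/
lemma ACderivOn.sum_volume_image_le {f f' : ℝ → ℝ} {a b : ℝ} (h : ACderivOn f f' a b)
    (hab : a ≤ b) {n : ℕ} (hn : 0 < n) :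
    ∑ i ∈ Finset.range n,
        volume (f '' Icc (partitionPoint a b n i) (partitionPoint a b n (i + 1))) ≤
      ENNReal.ofReal (∫ x in a..b, |f' x|) := by
  have hmono := partitionPoint_mono hab n
  have hmem : ∀ i < n, partitionPoint a b n i ∈ Icc a b ∧
      partitionPoint a b n (i + 1) ∈ Icc a b := fun i hi =>
    ⟨partitionPoint_mem_Icc hab hn hi.le, partitionPoint_mem_Icc hab hn hi⟩
  calc
    _ ≤ ∑ i ∈ Finset.range n, ENNReal.ofReal
          (∫ x in partitionPoint a b n i..partitionPoint a b n (i + 1), |f' x|) := by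
      refine Finset.sum_le_sum fun i hi => ?_
      have hi' := hmem i (Finset.mem_range.1 hi)
      exact h.volume_image_Icc_le hi'.1.1 (hmono i.le_succ) hi'.2.2
    _ = ENNReal.ofReal (∑ i ∈ Finset.range n,
          ∫ x in partitionPoint a b n i..partitionPoint a b n (i + 1), |f' x|) := by
      refine (ENNReal.ofReal_sum_of_nonneg fun i _ => ?_).symm
      exact intervalIntegral.integral_nonneg (hmono i.le_succ) fun _ _ => abs_nonneg _
    _ = _ := by
      rw [intervalIntegral.sum_integral_adjacent_intervals, partitionPoint_zero,
        partitionPoint_self a b hn]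
      intro i hi
      refine h.1.abs.mono_set ?_
      rw [uIcc_of_le hab]
      exact uIcc_subset_Icc (hmem i hi).1 (hmem i hi).2

/-- A finite part of a level set is eventually separated by the uniform partitions. -/
lemma eventually_card_le_sum_indicator {f : ℝ → ℝ} {a b t : ℝ} {S : Finset ℝ}
    (hS : ∀ x ∈ S, x ∈ Ioo a b ∧ f x = t) :
    ∀ᶠ n : ℕ in atTop, (S.card : ℝ≥0∞) ≤ ∑ i ∈ Finset.range n,
      (f '' Icc (partitionPoint a b n i) (partitionPoint a b n (i + 1))).indicator 1 t := by
  classical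
  have hsep : ∀ᶠ n : ℕ in atTop, ∀ x ∈ S, ∀ y ∈ S, x ≠ y → b - a ≤ |x - y| * n := by
    simp only [Filter.eventually_all_finset, Filter.eventually_imp_distrib_left]
    intro x _ y _ hxy
    exact (tendsto_natCast_atTop_atTop.const_mul_atTop
      (abs_pos.2 (sub_ne_zero.2 hxy))).eventually_ge_atTop _
  filter_upwards [hsep, eventually_gt_atTop 0] with n hsep hn
  have hn' : (0 : ℝ) < n := by exact_mod_cast hn
  simp only [indicator_apply, Pi.one_apply, Finset.sum_boole]
  norm_cast
  refine Finset.card_le_card_of_injOn (fun x => ⌊(x - a) / (b - a) * n⌋₊) ?_ ?_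
  · intro x hx
    obtain ⟨⟨hax, hxb⟩, hxt⟩ := hS x hx
    have hab : 0 < b - a := by linarith
    have hax' : 0 < x - a := sub_pos.2 hax
    have hpos : 0 ≤ (x - a) / (b - a) * n := by positivity
    simp only [Finset.coe_filter, Finset.mem_range, mem_ofPred_eq]
    refine ⟨?_, x, ⟨?_, ?_⟩, hxt⟩
    · rw [Nat.floor_lt hpos]
      have : (x - a) / (b - a) < 1 := by rw [div_lt_one hab]; linarith
      nlinarith
    · have h1 := Nat.floor_le hpos
      rw [← div_le_iff₀ hn', le_div_iff₀' hab] at h1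
      unfold partitionPoint
      linarith
    · have h1 := (Nat.lt_floor_add_one ((x - a) / (b - a) * n)).le
      rw [← le_div_iff₀ hn', div_le_iff₀' hab] at h1
      unfold partitionPoint
      push_cast
      linarith
  · intro x hx y hy hxy
    by_contra hne
    have hax := (hS x hx).1
    have hay := (hS y hy).1
    have hab : 0 < b - a := by linarith [hax.1, hax.2]
    have hax' : 0 < x - a := sub_pos.2 hax.1
    have hay' : 0 < y - a := sub_pos.2 hay.1
    have h1 := Nat.floor_le (show 0 ≤ (x - a) / (b - a) * n by positivity)
    have h2 := Nat.lt_floor_add_one ((x - a) / (b - a) * n)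
    have h3 := Nat.floor_le (show 0 ≤ (y - a) / (b - a) * n by positivity)
    have h4 := Nat.lt_floor_add_one ((y - a) / (b - a) * n)
    simp only at hxy
    rw [hxy] at h1 h2
    have h5 : |(x - a) / (b - a) * n - (y - a) / (b - a) * n| < 1 := by
      rw [abs_lt]; constructor <;> linarith
    have h6 : (x - a) / (b - a) * n - (y - a) / (b - a) * n = (x - y) * n / (b - a) := by
      ring
    rw [h6, abs_div, abs_mul, abs_of_pos hab, abs_of_pos hn', div_lt_one hab] at h5
    exact absurd (hsep x hx y hy hne) (not_le.2 h5)

/-- If every level in `J` is attained at least `m` times on `(a, b)`, then `m` times the measure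
of `J` is at most the total variation. -/
lemma ACderivOn.card_mul_volume_le {f f' : ℝ → ℝ} {a b : ℝ} (h : ACderivOn f f' a b)
    (hab : a ≤ b) (hf : ContinuousOn f (Icc a b)) {J : Set ℝ} (hJ : MeasurableSet J) {m : ℕ}
    (hm : ∀ t ∈ J, ∃ S : Finset ℝ, S.card = m ∧ ∀ x ∈ S, x ∈ Ioo a b ∧ f x = t) :
    m * volume J ≤ ENNReal.ofReal (∫ x in a..b, |f' x|) := by
  have hmeas : ∀ n : ℕ, 0 < n → ∀ i < n, MeasurableSet
      (f '' Icc (partitionPoint a b n i) (partitionPoint a b n (i + 1))) := fun n hn i hi =>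
    (isCompact_Icc.image_of_continuousOn (hf.mono (Icc_subset_Icc
      (partitionPoint_mem_Icc hab hn hi.le).1
      (partitionPoint_mem_Icc hab hn hi).2))).measurableSet
  let N : ℕ → ℝ → ℝ≥0∞ := fun n t => ∑ i ∈ Finset.range (n + 1),
    (f '' Icc (partitionPoint a b (n + 1) i) (partitionPoint a b (n + 1) (i + 1))).indicator 1 t
  have hN : ∀ n, Measurable (N n) := fun n =>
    Finset.measurable_sum _ fun i hi =>
      measurable_one.indicator (hmeas _ n.succ_pos i (Finset.mem_range.1 hi))
  calc
    m * volume J = ∫⁻ _ in J, (m : ℝ≥0∞) := (setLIntegral_const _ _).symm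
    _ ≤ ∫⁻ t in J, liminf (fun n => N n t) atTop := by
      refine setLIntegral_mono' hJ fun t ht => ?_
      obtain ⟨S, rfl, hS⟩ := hm t ht
      exact le_liminf_of_le (by isBoundedDefault)
        ((tendsto_add_atTop_nat 1).eventually (eventually_card_le_sum_indicator hS))
    _ ≤ ∫⁻ t, liminf (fun n => N n t) atTop := setLIntegral_le_lintegral _ _
    _ ≤ liminf (fun n => ∫⁻ t, N n t) atTop := lintegral_liminf_le hN
    _ ≤ _ := by
      refine liminf_le_of_frequently_le' (Frequently.of_forall fun n => ?_)
      rw [lintegral_finsetSum' _ fun i hi => (measurable_one.indicator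
        (hmeas _ n.succ_pos i (Finset.mem_range.1 hi))).aemeasurable]
      refine le_trans (Finset.sum_le_sum fun i hi => ?_) (h.sum_volume_image_le hab n.succ_pos)
      rw [lintegral_indicator_one (hmeas _ n.succ_pos i (Finset.mem_range.1 hi))]

/-- Banach-indicatrix / coarea bound: an absolutely continuous function on `[-1, 1]`
whose derivative has `L¹` norm at most `C` admits, in every value range `(σ, δ)`, a
level `t` whose level set in `(-1, 1)` is finite with at most `C / (δ - σ)` points. -/
theorem exists_small_level_set
    (C : ℝ) (hC : 0 < C) (c g : ℝ → ℝ)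
    (hcont : ContinuousOn c (Set.Icc (-1 : ℝ) 1))
    (hAC : ACderivOn c g (-1) 1)
    (hg : (∫⁻ x in Set.Icc (-1 : ℝ) 1, ENNReal.ofReal |g x|) ≤ ENNReal.ofReal C) :
    ∀ σ δ : ℝ, 0 < σ → σ < δ →
      ∃ t ∈ Set.Ioo σ δ,
        ∃ hfin : {x ∈ Set.Ioo (-1 : ℝ) 1 | c x = t}.Finite,
          (hfin.toFinset.card : ℝ) ≤ C / (δ - σ) := by
  intro σ δ _ hσδ
  have hlen : 0 < δ - σ := sub_pos.2 hσδ
  by_contra! hcon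
  have hvar : ENNReal.ofReal (∫ x in (-1 : ℝ)..1, |g x|) ≤ ENNReal.ofReal C := by
    rw [intervalIntegral.integral_of_le (by norm_num), ← integral_Icc_eq_integral_Ioc,
      ofReal_integral_eq_lintegral_ofReal]
    · exact hg
    · exact (integrableOn_Icc_iff_integrableOn_Ioc (μ := volume)).2 hAC.1.abs.1
    · exact ae_of_all _ fun _ => abs_nonneg _
  have hmany : ∀ t ∈ Ioo σ δ, ∃ S : Finset ℝ, S.card = ⌊C / (δ - σ)⌋₊ + 1 ∧
      ∀ x ∈ S, x ∈ Ioo (-1 : ℝ) 1 ∧ c x = t := by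
    intro t ht
    by_cases hfin : {x ∈ Ioo (-1 : ℝ) 1 | c x = t}.Finite
    · have hlt := (Nat.floor_lt (by positivity)).2 (hcon t ht hfin)
      obtain ⟨S, hS, hcard⟩ := Finset.exists_subset_card_eq (Nat.succ_le_of_lt hlt)
      exact ⟨S, hcard, fun x hx => (hfin.mem_toFinset).1 (hS hx)⟩
    · obtain ⟨S, hS, hcard⟩ := Set.Infinite.exists_subset_card_eq hfin (⌊C / (δ - σ)⌋₊ + 1)
      exact ⟨S, hcard, fun x hx => hS hx⟩
  have hle := (hAC.card_mul_volume_le (by norm_num) hcont measurableSet_Ioo hmany).trans hvar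
  rw [Real.volume_Ioo, ← ENNReal.ofReal_natCast, ← ENNReal.ofReal_mul (Nat.cast_nonneg _),
    ENNReal.ofReal_le_ofReal_iff hC.le, ← le_div_iff₀ hlen] at hle
  push_cast at hle
  exact absurd (Nat.lt_floor_add_one (C / (δ - σ))) (not_lt.2 hle)
end
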